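/- Any nondisturbing measurement by the second party is trivial on the 4p−4 states: if C is an n×n complex positive semidefinite (Hermitian) matrix with entries C_{ab} (0 ≤ a,b ≤ n−1) such that ⟨ψ_k, (I_m ⊗ C) ψ_l⟩ = 0 for all k, l with 1 ≤ k, l ≤ 4p−4 and k ≠ l, then ⟨ψ_k, (I_m ⊗ C) ψ_k⟩ = C_{00} for every k with 1 ≤ k ≤ 4p−4. -/

import Mathlib

open scoped ComplexInnerProductSpace Kronecker ComplexOrder

/-- The `i`-th standard basis vector `|i⟩` of `ℂ^m` (zero if `i ≥ m`). -/
noncomputable def ket (m i : ℕ) : EuclideanSpace ℂ (Fin m) :=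
  (WithLp.equiv 2 (Fin m → ℂ)).symm fun a => if (a : ℕ) = i then 1 else 0

/-- The product state `v ⊗ w`, with entries `(v ⊗ w)_{(a,b)} = v_a * w_b`. -/
noncomputable def tp {m n : ℕ} (v : EuclideanSpace ℂ (Fin m)) (w : EuclideanSpace ℂ (Fin n)) :
    EuclideanSpace ℂ (Fin m × Fin n) :=
  (WithLp.equiv 2 (Fin m × Fin n → ℂ)).symm fun ab => v ab.1 * w ab.2

/-- The scalar `1/√2`. -/
noncomputable def invSqrt2 : ℂ := ((Real.sqrt 2)⁻¹ : ℝ)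

/-- A matrix on `ℂ^m ⊗ ℂ^n` acting as a linear map. -/
noncomputable def act {m n : ℕ} (M : Matrix (Fin m × Fin n) (Fin m × Fin n) ℂ)
    (x : EuclideanSpace ℂ (Fin m × Fin n)) : EuclideanSpace ℂ (Fin m × Fin n) :=
  Matrix.toEuclideanLin M x

/-- The index `j(i)`: `j(i) = i + 1` for `i ≤ p - 2`, and `j(p-1) = 1`. -/
def jf (p i : ℕ) : ℕ := if i = p - 1 then 1 else i + 1

/-- The `4p-4` product states `ψ_k` (`1 ≤ k ≤ 4p-4`):
`ψ_i = |i⟩ ⊗ (|0⟩-|i⟩)/√2`, `ψ_{i+p-1} = (|0⟩-|i⟩)/√2 ⊗ |j(i)⟩`,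
`ψ_{i+2p-2} = |i⟩ ⊗ (|0⟩+|i⟩)/√2`, `ψ_{i+3p-3} = (|0⟩+|i⟩)/√2 ⊗ |j(i)⟩`, for `1 ≤ i ≤ p-1`. -/
noncomputable def psi (m n p k : ℕ) : EuclideanSpace ℂ (Fin m × Fin n) :=
  if k ≤ p - 1 then tp (ket m k) (invSqrt2 • (ket n 0 - ket n k))
  else if k ≤ 2 * p - 2 then
    tp (invSqrt2 • (ket m 0 - ket m (k - (p - 1)))) (ket n (jf p (k - (p - 1))))
  else if k ≤ 3 * p - 3 then
    tp (ket m (k - (2 * p - 2))) (invSqrt2 • (ket n 0 + ket n (k - (2 * p - 2))))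
  else tp (invSqrt2 • (ket m 0 + ket m (k - (3 * p - 3)))) (ket n (jf p (k - (3 * p - 3))))

theorem inner_tp_act_one_kronecker {m n : ℕ} (C : Matrix (Fin n) (Fin n) ℂ)
    (v v' : EuclideanSpace ℂ (Fin m)) (w w' : EuclideanSpace ℂ (Fin n)) :
    ⟪tp v w, act ((1 : Matrix (Fin m) (Fin m) ℂ) ⊗ₖ C) (tp v' w')⟫ =
      ⟪v, v'⟫ * ⟪w, Matrix.toEuclideanLin C w'⟫ := by
  simp only [PiLp.inner_apply, RCLike.inner_apply, act, tp, Matrix.toLpLin_apply, Matrix.mulVec,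
    dotProduct, Fintype.sum_prod_type, Matrix.kroneckerMap_apply, Matrix.one_apply,
    WithLp.equiv_symm_apply, map_mul, ite_mul, one_mul, zero_mul, Finset.sum_mul_sum]
  refine Finset.sum_congr rfl fun a _ => Finset.sum_congr rfl fun b _ => ?_
  rw [Finset.sum_eq_single a (fun x _ hx => by simp [hx.symm]) (by simp)]
  simp only [if_true, Finset.sum_mul, Finset.mul_sum]
  exact Finset.sum_congr rfl fun c _ => by ring

theorem inner_ket_ket {m a : ℕ} (ha : a < m) (b : ℕ) :
    ⟪ket m a, ket m b⟫ = if a = b then 1 else 0 := by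
  rw [PiLp.inner_apply, Finset.sum_eq_single (⟨a, ha⟩ : Fin m)]
  · simp [ket]
  · intro x _ hx
    have : (x : ℕ) ≠ a := fun h => hx (Fin.ext h)
    simp [ket, this]
  · simp

theorem inner_ket_toEuclideanLin_ket {n a b : ℕ} (ha : a < n) (hb : b < n)
    (C : Matrix (Fin n) (Fin n) ℂ) :
    ⟪ket n a, Matrix.toEuclideanLin C (ket n b)⟫ = C ⟨a, ha⟩ ⟨b, hb⟩ := by
  have hket : ∀ c (hc : c < n), ket n c = EuclideanSpace.single (⟨c, hc⟩ : Fin n) (1 : ℂ) := by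
    intro c hc
    ext x
    simp [ket, Fin.ext_iff]
  rw [hket a ha, hket b hb, EuclideanSpace.inner_single_left]
  simp [Matrix.toLpLin_apply]

theorem conj_invSqrt2 : (starRingEnd ℂ) invSqrt2 = invSqrt2 := Complex.conj_ofReal _

theorem invSqrt2_mul_self : invSqrt2 * invSqrt2 = 1 / 2 := by
  rw [invSqrt2, ← Complex.ofReal_mul, ← mul_inv, Real.mul_self_sqrt (by norm_num)]
  norm_num

section families

variable (m n : ℕ) {p i : ℕ}

theorem psi_ket_sub (hi' : i ≤ p - 1) :
    psi m n p i = tp (ket m i) (invSqrt2 • (ket n 0 - ket n i)) := by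
  rw [psi, if_pos hi']

theorem psi_sub_ket (hi : 1 ≤ i) (hi' : i ≤ p - 1) :
    psi m n p (i + (p - 1)) = tp (invSqrt2 • (ket m 0 - ket m i)) (ket n (jf p i)) := by
  rw [psi, if_neg (by omega), if_pos (by omega), Nat.add_sub_cancel]

theorem psi_ket_add (hi : 1 ≤ i) (hi' : i ≤ p - 1) :
    psi m n p (i + (2 * p - 2)) = tp (ket m i) (invSqrt2 • (ket n 0 + ket n i)) := by
  rw [psi, if_neg (by omega), if_neg (by omega), if_pos (by omega), Nat.add_sub_cancel]

theorem psi_add_ket (hi : 1 ≤ i) (hi' : i ≤ p - 1) :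
    psi m n p (i + (3 * p - 3)) = tp (invSqrt2 • (ket m 0 + ket m i)) (ket n (jf p i)) := by
  rw [psi, if_neg (by omega), if_neg (by omega), if_neg (by omega), Nat.add_sub_cancel]

end families

theorem jf_mem {p i : ℕ} (h3 : 3 ≤ p) (hi : 1 ≤ i) (hi' : i ≤ p - 1) :
    1 ≤ jf p i ∧ jf p i ≤ p - 1 ∧ jf p i ≠ i := by
  unfold jf; split_ifs <;> omega

theorem exists_jf_eq {p a : ℕ} (ha : 1 ≤ a) (ha' : a ≤ p - 1) :
    ∃ i, 1 ≤ i ∧ i ≤ p - 1 ∧ jf p i = a := by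
  by_cases h : a = 1
  · exact ⟨p - 1, by omega, le_rfl, by simp [jf, h]⟩
  · exact ⟨a - 1, by omega, by omega, by rw [jf, if_neg (by omega)]; omega⟩

theorem bob_measurement_trivial (p m n : ℕ) (h3 : 3 ≤ p) (hpm : p ≤ m) (hmn : m ≤ n)
    (C : Matrix (Fin n) (Fin n) ℂ) (hC : C.PosSemidef)
    (h : ∀ k l : ℕ, 1 ≤ k → k ≤ 4 * p - 4 → 1 ≤ l → l ≤ 4 * p - 4 → k ≠ l →
      ⟪psi m n p k, act ((1 : Matrix (Fin m) (Fin m) ℂ) ⊗ₖ C) (psi m n p l)⟫ = 0) :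
    ∀ k, 1 ≤ k → k ≤ 4 * p - 4 →
      ⟪psi m n p k, act ((1 : Matrix (Fin m) (Fin m) ℂ) ⊗ₖ C) (psi m n p k)⟫ =
        C (⟨0, by omega⟩ : Fin n) (⟨0, by omega⟩ : Fin n) := by
  have hm : 0 < m := by omega
  rw [← inner_ket_toEuclideanLin_ket (show 0 < n by omega) (show 0 < n by omega) C]
  set E : ℕ → ℕ → ℂ := fun a b => ⟪ket n a, Matrix.toEuclideanLin C (ket n b)⟫ with hE
  have hEab : ∀ a b, ⟪ket n a, Matrix.toEuclideanLin C (ket n b)⟫ = E a b := fun _ _ => rfl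
  have hs := invSqrt2_mul_self
  have hoff : ∀ a b, 1 ≤ a → a ≤ p - 1 → 1 ≤ b → b ≤ p - 1 → a ≠ b → E a b = 0 := by
    intro a b ha ha' hb hb' hab
    obtain ⟨i, hi, hi', rfl⟩ := exists_jf_eq ha ha'
    obtain ⟨l, hl, hl', rfl⟩ := exists_jf_eq hb hb'
    have hil : i ≠ l := fun e => hab (by rw [e])
    have key := h (i + (p - 1)) (l + (p - 1)) (by omega) (by omega) (by omega) (by omega)
      (by omega)
    rw [psi_sub_ket m n hi hi', psi_sub_ket m n hl hl', inner_tp_act_one_kronecker] at key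
    simp only [inner_smul_left, inner_smul_right, inner_sub_left, inner_sub_right,
      conj_invSqrt2, inner_ket_ket hm, inner_ket_ket (show i < m by omega), hEab, hil,
      (show (0 : ℕ) ≠ l by omega), (show i ≠ 0 by omega), if_true, if_false] at key
    linear_combination 2 * key - 2 * hs * E (jf p i) (jf p l)
  have hzero : ∀ a, 1 ≤ a → a ≤ p - 1 → E 0 a = 0 := by
    intro a ha ha'
    obtain ⟨i, hi, hi', rfl⟩ := exists_jf_eq ha ha'
    have key := h i (i + (p - 1)) (by omega) (by omega) (by omega) (by omega) (by omega)
    rw [psi_ket_sub m n hi', psi_sub_ket m n hi hi', inner_tp_act_one_kronecker] at key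
    simp only [inner_smul_left, inner_smul_right, inner_sub_left, inner_sub_right,
      conj_invSqrt2, inner_ket_ket (show i < m by omega), hEab,
      (show i ≠ 0 by omega), if_true, if_false,
      hoff i (jf p i) hi hi' ha ha' (jf_mem h3 hi hi').2.2.symm] at key
    linear_combination -2 * key - 2 * hs * E 0 (jf p i)
  have hdiag : ∀ i, 1 ≤ i → i ≤ p - 1 → E i i = E 0 0 ∧ E i 0 = 0 := by
    intro i hi hi'
    have key := h i (i + (2 * p - 2)) (by omega) (by omega) (by omega) (by omega) (by omega)
    have key' := h (i + (2 * p - 2)) i (by omega) (by omega) (by omega) (by omega) (by omega)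
    rw [psi_ket_sub m n hi', psi_ket_add m n hi hi', inner_tp_act_one_kronecker] at key key'
    simp only [inner_smul_left, inner_smul_right, inner_sub_left, inner_sub_right,
      inner_add_left, inner_add_right, map_smul, map_sub, map_add,
      conj_invSqrt2, inner_ket_ket (show i < m by omega), hEab,
      if_true, hzero i hi hi'] at key key'
    exact ⟨by linear_combination -key - key' + 2 * hs * (E 0 0 - E i i),
      by linear_combination key' - key - 2 * hs * E i 0⟩
  intro k hk hk'
  by_cases h1 : k ≤ p - 1
  · obtain ⟨hd, h0⟩ := hdiag k hk h1
    rw [psi_ket_sub m n h1, inner_tp_act_one_kronecker]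
    simp only [inner_smul_left, inner_smul_right, inner_sub_left, inner_sub_right, map_smul,
      map_sub, conj_invSqrt2, inner_ket_ket (show k < m by omega), hEab, if_true,
      hzero k hk h1, hd, h0]
    linear_combination 2 * hs * E 0 0
  by_cases h2 : k ≤ 2 * p - 2
  · obtain ⟨i, rfl⟩ : ∃ i, k = i + (p - 1) := ⟨k - (p - 1), by omega⟩
    have hi : 1 ≤ i := by omega
    have hi' : i ≤ p - 1 := by omega
    obtain ⟨hj, hj', -⟩ := jf_mem h3 hi hi'
    rw [psi_sub_ket m n hi hi', inner_tp_act_one_kronecker]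
    simp only [inner_smul_left, inner_smul_right, inner_sub_left, inner_sub_right,
      conj_invSqrt2, inner_ket_ket hm, inner_ket_ket (show i < m by omega), hEab,
      (show (0 : ℕ) ≠ i by omega), (show i ≠ 0 by omega), if_true, if_false, (hdiag _ hj hj').1]
    linear_combination 2 * hs * E 0 0
  by_cases h3' : k ≤ 3 * p - 3
  · obtain ⟨i, rfl⟩ : ∃ i, k = i + (2 * p - 2) := ⟨k - (2 * p - 2), by omega⟩
    have hi : 1 ≤ i := by omega
    have hi' : i ≤ p - 1 := by omega
    obtain ⟨hd, h0⟩ := hdiag i hi hi'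
    rw [psi_ket_add m n hi hi', inner_tp_act_one_kronecker]
    simp only [inner_smul_left, inner_smul_right, inner_add_left, inner_add_right, map_smul,
      map_add, conj_invSqrt2, inner_ket_ket (show i < m by omega), hEab, if_true,
      hzero i hi hi', hd, h0]
    linear_combination 2 * hs * E 0 0
  · obtain ⟨i, rfl⟩ : ∃ i, k = i + (3 * p - 3) := ⟨k - (3 * p - 3), by omega⟩
    have hi : 1 ≤ i := by omega
    have hi' : i ≤ p - 1 := by omega
    obtain ⟨hj, hj', -⟩ := jf_mem h3 hi hi'
    rw [psi_add_ket m n hi hi', inner_tp_act_one_kronecker]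
    simp only [inner_smul_left, inner_smul_right, inner_add_left, inner_add_right,
      conj_invSqrt2, inner_ket_ket hm, inner_ket_ket (show i < m by omega), hEab,
      (show (0 : ℕ) ≠ i by omega), (show i ≠ 0 by omega), if_true, if_false, (hdiag _ hj hj').1]
    linear_combination 2 * hs * E 0 0
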